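/- Fix an integer N ≥ 1 and a real number p > 1, let d ∈ ℝ^N with |d| < 1, γ = (1−|d|²)^{−1/2}, and λ ∈ ℂ. Suppose φ is smooth on an open neighborhood of the closed unit ball of ℝ^N and satisfies the eigen-equation for (d, λ). Define ψ(y') = (1 − d·y')^{−λ} (γ(1 − d·y'))^{−2/(p−1)} φ( ( y' − γd + (γ²(d·y')/(1+γ)) d ) / ( γ(1 − d·y') ) ), where (1 − d·y')^{−λ} is the complex power of the positive real number 1 − d·y'. Then the map y' ↦ ( y' − γd + (γ²(d·y')/(1+γ)) d ) / ( γ(1 − d·y') ) sends the closed unit ball into the closed unit ball, ψ is smooth on (a neighborhood of) the closed unit ball, ψ satisfies the eigen-equation for (0, λ), and ψ is not identically zero on the closed unit ball whenever φ is not identically zero on the closed unit ball. -/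

import Mathlib

open scoped RealInnerProductSpace

noncomputable section

/-- The constant `κ₀ = (2(p+1)/(p-1)²)^{1/(p-1)}`. -/
def kappa0 (p : ℝ) : ℝ := (2 * (p + 1) / (p - 1) ^ 2) ^ (1 / (p - 1))

/-- The boosted self-similar profile `κ_d(y) = κ₀ (1-|d|²)^{1/(p-1)} (1+d⬝y)^{-2/(p-1)}`. -/
def kd {N : ℕ} (p : ℝ) (d y : EuclideanSpace ℝ (Fin N)) : ℝ :=
  kappa0 p * (1 - ‖d‖ ^ 2) ^ (1 / (p - 1)) * (1 + ⟪d, y⟫) ^ (-(2 / (p - 1)))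

/-- Partial derivative of a real-valued function in the `i`-th coordinate direction. -/
def pd {N : ℕ} (i : Fin N) (f : EuclideanSpace ℝ (Fin N) → ℝ)
    (y : EuclideanSpace ℝ (Fin N)) : ℝ :=
  fderiv ℝ f y (EuclideanSpace.single i 1)

/-- Derivative in the first (time) variable. -/
def dT {N : ℕ} (u : ℝ × EuclideanSpace ℝ (Fin N) → ℝ) (t : ℝ)
    (x : EuclideanSpace ℝ (Fin N)) : ℝ := deriv (fun t' => u (t', x)) t

/-- Second derivative in the first (time) variable. -/
def dTT {N : ℕ} (u : ℝ × EuclideanSpace ℝ (Fin N) → ℝ) (t : ℝ)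
    (x : EuclideanSpace ℝ (Fin N)) : ℝ := deriv (fun t' => dT u t' x) t

/-- Spatial Laplacian. -/
def lapX {N : ℕ} (u : ℝ × EuclideanSpace ℝ (Fin N) → ℝ) (t : ℝ)
    (x : EuclideanSpace ℝ (Fin N)) : ℝ :=
  ∑ i : Fin N, pd i (pd i (fun z => u (t, z))) x

/-- `u` satisfies `∂ₜₜu − Δₓu = |u|^{p−1}u` at the point `q = (t, x)`. -/
def WaveEqAt {N : ℕ} (p : ℝ) (u : ℝ × EuclideanSpace ℝ (Fin N) → ℝ)
    (q : ℝ × EuclideanSpace ℝ (Fin N)) : Prop :=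
  dTT u q.1 q.2 - lapX u q.1 q.2 = |u q| ^ (p - 1) * u q

/-- `U` satisfies the self-similar wave equation at `(s, y)`. -/
def SSat {N : ℕ} (p : ℝ) (U : ℝ × EuclideanSpace ℝ (Fin N) → ℝ) (s : ℝ)
    (y : EuclideanSpace ℝ (Fin N)) : Prop :=
  dTT U s y + (p + 3) / (p - 1) * dT U s y
    + 2 * (∑ i : Fin N, y i * pd i (fun z => dT U s z) y)
    + 2 * (p + 1) / (p - 1) * (∑ i : Fin N, y i * pd i (fun z => U (s, z)) y)
    + (∑ i : Fin N, ∑ j : Fin N,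
        (y i * y j - if i = j then (1 : ℝ) else 0) * pd i (pd j (fun z => U (s, z))) y)
    + 2 * (p + 1) / (p - 1) ^ 2 * U (s, y)
    = |U (s, y)| ^ (p - 1) * U (s, y)

/-- `η` satisfies the linearized self-similar equation with potential `V` at `(s, y)`. -/
def LinEqAt {N : ℕ} (p : ℝ) (V : EuclideanSpace ℝ (Fin N) → ℝ)
    (η : ℝ × EuclideanSpace ℝ (Fin N) → ℝ) (s : ℝ)
    (y : EuclideanSpace ℝ (Fin N)) : Prop :=
  dTT η s y + (p + 3) / (p - 1) * dT η s y
    + 2 * (∑ i : Fin N, y i * pd i (fun z => dT η s z) y)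
    + 2 * (p + 1) / (p - 1) * (∑ i : Fin N, y i * pd i (fun z => η (s, z)) y)
    + (∑ i : Fin N, ∑ j : Fin N,
        (y i * y j - if i = j then (1 : ℝ) else 0) * pd i (pd j (fun z => η (s, z))) y)
    + (2 * (p + 1) / (p - 1) ^ 2 - V y) * η (s, y) = 0

/-- The Lorentz boost `Λ_β(t,x) = (γ(t − β⬝x), x − γβt + (γ²(β⬝x)/(1+γ))β)`,
with `γ = (1−|β|²)^{−1/2}`. -/
def boost {N : ℕ} (β : EuclideanSpace ℝ (Fin N)) (q : ℝ × EuclideanSpace ℝ (Fin N)) :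
    ℝ × EuclideanSpace ℝ (Fin N) :=
  (((1 - ‖β‖ ^ 2) ^ (-(1 / 2) : ℝ)) * (q.1 - ⟪β, q.2⟫),
    q.2 - (((1 - ‖β‖ ^ 2) ^ (-(1 / 2) : ℝ)) * q.1) • β
      + ((((1 - ‖β‖ ^ 2) ^ (-(1 / 2) : ℝ)) ^ 2 * ⟪β, q.2⟫)
          / (1 + (1 - ‖β‖ ^ 2) ^ (-(1 / 2) : ℝ))) • β)

/-- The spatial map `y' ↦ (y' − γβ + (γ²(β⬝y')/(1+γ))β) / (γ(1 − β⬝y'))` of the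
Lorentz transform in self-similar variables. -/
def ymap {N : ℕ} (β y' : EuclideanSpace ℝ (Fin N)) : EuclideanSpace ℝ (Fin N) :=
  (((1 - ‖β‖ ^ 2) ^ (-(1 / 2) : ℝ)) * (1 - ⟪β, y'⟫))⁻¹
    • (y' - ((1 - ‖β‖ ^ 2) ^ (-(1 / 2) : ℝ)) • β
        + ((((1 - ‖β‖ ^ 2) ^ (-(1 / 2) : ℝ)) ^ 2 * ⟪β, y'⟫)
            / (1 + (1 - ‖β‖ ^ 2) ^ (-(1 / 2) : ℝ))) • β)

/-- The Lorentz transform `𝒯_β` in self-similar variables: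
`(𝒯_β U)(s',y') = (γ(1 − β⬝y'))^{−2/(p−1)} U(s' − log(1 − β⬝y'), ymap β y')`. -/
def lorentzSS {N : ℕ} (p : ℝ) (β : EuclideanSpace ℝ (Fin N))
    (U : ℝ × EuclideanSpace ℝ (Fin N) → ℝ) (q : ℝ × EuclideanSpace ℝ (Fin N)) : ℝ :=
  (((1 - ‖β‖ ^ 2) ^ (-(1 / 2) : ℝ)) * (1 - ⟪β, q.2⟫)) ^ (-(2 / (p - 1)))
    * U (q.1 - Real.log (1 - ⟪β, q.2⟫), ymap β q.2)

/-- Partial derivative of a complex-valued function in the `i`-th coordinate direction. -/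
def pdC {N : ℕ} (i : Fin N) (f : EuclideanSpace ℝ (Fin N) → ℂ)
    (y : EuclideanSpace ℝ (Fin N)) : ℂ :=
  fderiv ℝ f y (EuclideanSpace.single i 1)

/-- The eigen-equation for `(d, λ)` at a point `y`. -/
def EigenEqAt {N : ℕ} (p : ℝ) (d : EuclideanSpace ℝ (Fin N)) (lam : ℂ)
    (φ : EuclideanSpace ℝ (Fin N) → ℂ) (y : EuclideanSpace ℝ (Fin N)) : Prop :=
  (lam ^ 2 + (((p + 3) / (p - 1) : ℝ) : ℂ) * lam + ((2 * (p + 1) / (p - 1) ^ 2 : ℝ) : ℂ)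
      - ((p * kd p d y ^ (p - 1) : ℝ) : ℂ)) * φ y
    + (2 * lam + ((2 * (p + 1) / (p - 1) : ℝ) : ℂ))
        * (∑ i : Fin N, (y i : ℂ) * pdC i φ y)
    + (∑ i : Fin N, ∑ j : Fin N,
        (((y i * y j - if i = j then (1 : ℝ) else 0) : ℝ) : ℂ) * pdC i (pdC j φ) y)
    = 0

/-- `λ` is an eigenvalue of the linearized operator around `κ_d`: the eigen-equation for
`(d, λ)` has a solution smooth on an open neighborhood of the closed unit ball that is
not identically zero on the closed unit ball. -/
def IsEigenvalue (N : ℕ) (p : ℝ) (d : EuclideanSpace ℝ (Fin N)) (lam : ℂ) : Prop :=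
  ∃ φ : EuclideanSpace ℝ (Fin N) → ℂ, ∃ Ω : Set (EuclideanSpace ℝ (Fin N)),
    IsOpen Ω ∧ Metric.closedBall 0 1 ⊆ Ω ∧ ContDiffOn ℝ (⊤ : ℕ∞) φ Ω ∧
    (∀ y ∈ Metric.closedBall (0 : EuclideanSpace ℝ (Fin N)) 1, EigenEqAt p d lam φ y) ∧
    ∃ y ∈ Metric.closedBall (0 : EuclideanSpace ℝ (Fin N)) 1, φ y ≠ 0


section Helpers

/-- Second derivative as a bilinear expression. -/
def hess {F : Type*} [NormedAddCommGroup F] [NormedSpace ℝ F] (W : F → ℂ) (q u v : F) : ℂ :=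
  fderiv ℝ (fderiv ℝ W) q u v

/-- The wave operator. -/
def box {N : ℕ} (W : ℝ × (EuclideanSpace ℝ (Fin N)) → ℂ) (q : ℝ × (EuclideanSpace ℝ (Fin N))) : ℂ :=
  hess W q (1, 0) (1, 0)
    - ∑ i : Fin N, hess W q (0, EuclideanSpace.single i 1) (0, EuclideanSpace.single i 1)

theorem fderiv_comp_affine {E F : Type*} [NormedAddCommGroup E] [NormedSpace ℝ E]
    [NormedAddCommGroup F] [NormedSpace ℝ F] (W : F → ℂ) (A : E → F) (L : E →L[ℝ] F)
    (hA : ∀ x, HasFDerivAt A L x) (x : E) (hW : ContDiffAt ℝ 2 W (A x)) :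
    (fderiv ℝ (fun z => W (A z))) =ᶠ[nhds x] (fun z => (fderiv ℝ W (A z)).comp L) := by
  have h1 : ∀ᶠ z in nhds x, ContDiffAt ℝ 2 W (A z) :=
    (hA x).continuousAt.eventually (hW.eventually (by simp))
  filter_upwards [h1] with z hz
  exact ((hz.differentiableAt (by simp)).hasFDerivAt.comp z (hA z)).fderiv

theorem hess_comp_affine {E F : Type*} [NormedAddCommGroup E] [NormedSpace ℝ E]
    [NormedAddCommGroup F] [NormedSpace ℝ F] (W : F → ℂ) (A : E → F) (L : E →L[ℝ] F)
    (hA : ∀ x, HasFDerivAt A L x) (x : E) (hW : ContDiffAt ℝ 2 W (A x)) (u v : E) :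
    hess (fun z => W (A z)) x u v = hess W (A x) (L u) (L v) := by
  unfold hess
  rw [(fderiv_comp_affine W A L hA x hW).fderiv_eq]
  have h2 : DifferentiableAt ℝ (fderiv ℝ W) (A x) :=
    (hW.fderiv_right (m := 1) (by norm_num)).differentiableAt (by simp)
  have h3 : HasFDerivAt (fun z => fderiv ℝ W (A z)) ((fderiv ℝ (fderiv ℝ W) (A x)).comp L) x :=
    h2.hasFDerivAt.comp x (hA x)
  rw [(h3.clm_comp (hasFDerivAt_const L x)).fderiv]
  simp

theorem hess_const_mul {F : Type*} [NormedAddCommGroup F] [NormedSpace ℝ F] (W : F → ℂ) (c : ℂ)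
    (q u v : F) : hess (fun z => c * W z) q u v = c * hess W q u v := by
  unfold hess
  have h : (fun z => c * W z) = c • W := by ext; simp
  have h2 : fderiv ℝ (c • fderiv ℝ W) = c • fderiv ℝ (fderiv ℝ W) :=
    fderiv_const_smul_field (𝕜 := ℝ) (F := F →L[ℝ] ℂ) (R := ℂ) (f := fderiv ℝ W) c
  rw [h, fderiv_const_smul_field, h2]
  simp

theorem hess_congr {F : Type*} [NormedAddCommGroup F] [NormedSpace ℝ F] {W V : F → ℂ}
    {q : F} (h : W =ᶠ[nhds q] V) (u v : F) : hess W q u v = hess V q u v := by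
  unfold hess
  rw [h.fderiv.fderiv_eq]

theorem hess_symm {F : Type*} [NormedAddCommGroup F] [NormedSpace ℝ F] {W : F → ℂ}
    {q : F} (h : ContDiffAt ℝ 2 W q) (u v : F) : hess W q u v = hess W q v u :=
  h.isSymmSndFDerivAt (by simp) u v

theorem box_const_mul {N : ℕ} (W : ℝ × (EuclideanSpace ℝ (Fin N)) → ℂ) (c : ℂ) (q : ℝ × (EuclideanSpace ℝ (Fin N))) :
    box (fun z => c * W z) q = c * box W q := by
  simp only [box, hess_const_mul, mul_sub, Finset.mul_sum]

/-- Homogeneity on an open cone. -/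
structure Homog {N : ℕ} (U : Set (ℝ × (EuclideanSpace ℝ (Fin N)))) (a : ℂ) (W : ℝ × (EuclideanSpace ℝ (Fin N)) → ℂ) : Prop where
  op : IsOpen U
  cone : ∀ c : ℝ, 0 < c → ∀ q ∈ U, c • q ∈ U
  smooth : ContDiffOn ℝ (⊤ : ℕ∞) W U
  hom : ∀ c : ℝ, 0 < c → ∀ q ∈ U, W (c • q) = Complex.exp (-a * (Real.log c : ℝ)) * W q

theorem Homog.contDiffAt {N : ℕ} {U : Set (ℝ × (EuclideanSpace ℝ (Fin N)))} {a : ℂ} {W : ℝ × (EuclideanSpace ℝ (Fin N)) → ℂ}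
    (h : Homog U a W) {q : ℝ × (EuclideanSpace ℝ (Fin N))} (hq : q ∈ U) : ContDiffAt ℝ 2 W q :=
  (h.smooth.contDiffAt (h.op.mem_nhds hq)).of_le (WithTop.coe_le_coe.2 (le_top : (2 : ℕ∞) ≤ ⊤))

theorem Homog.box_smul {N : ℕ} {U : Set (ℝ × (EuclideanSpace ℝ (Fin N)))} {a : ℂ} {W : ℝ × (EuclideanSpace ℝ (Fin N)) → ℂ}
    (h : Homog U a W) {q : ℝ × (EuclideanSpace ℝ (Fin N))} (hq : q ∈ U) (c : ℝ) (hc : 0 < c) :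
    (c : ℂ) ^ 2 * box W (c • q) = Complex.exp (-a * (Real.log c : ℝ)) * box W q := by
  rw [← box_const_mul W (Complex.exp (-a * (Real.log c : ℝ)))]
  have e : (fun z => Complex.exp (-a * (Real.log c : ℝ)) * W z) =ᶠ[nhds q]
      (fun z => W (c • z)) := by
    filter_upwards [h.op.mem_nhds hq] with z hz
    rw [h.hom c hc z hz]
  have hA : ∀ x : ℝ × (EuclideanSpace ℝ (Fin N)), HasFDerivAt (fun z : ℝ × (EuclideanSpace ℝ (Fin N)) => c • z)
      (c • ContinuousLinearMap.id ℝ (ℝ × (EuclideanSpace ℝ (Fin N)))) x := fun x => (hasFDerivAt_id x).const_smul c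
  have key : ∀ u v, hess (fun z => Complex.exp (-a * (Real.log c : ℝ)) * W z) q u v
      = (c : ℂ) ^ 2 * hess W (c • q) u v := by
    intro u v
    rw [hess_congr e, hess_comp_affine W _ _ hA q (h.contDiffAt (h.cone c hc q hq))]
    unfold hess
    simp only [_root_.smul_apply, ContinuousLinearMap.id_apply, map_smul]
    simp only [Complex.real_smul]
    ring
  simp only [box, key, mul_sub, Finset.mul_sum]

theorem Homog.euler1 {N : ℕ} {U : Set (ℝ × (EuclideanSpace ℝ (Fin N)))} {a : ℂ} {W : ℝ × (EuclideanSpace ℝ (Fin N)) → ℂ}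
    (h : Homog U a W) {q : ℝ × (EuclideanSpace ℝ (Fin N))} (hq : q ∈ U) : fderiv ℝ W q q = -a * W q := by
  have hd : HasFDerivAt W (fderiv ℝ W q) ((1 : ℝ) • q) := by
    rw [one_smul]
    exact ((h.contDiffAt hq).differentiableAt (by simp)).hasFDerivAt
  have h1 : HasDerivAt (fun c : ℝ => W (c • q)) (fderiv ℝ W q ((1 : ℝ) • q)) 1 :=
    hd.comp_hasDerivAt (1 : ℝ) ((hasDerivAt_id (1 : ℝ)).smul_const q)
  have h2 : HasDerivAt (fun c : ℝ => Complex.exp (-a * (Real.log c : ℝ)) * W q)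
      (-a * W q) 1 := by
    have h3 : HasDerivAt (fun c : ℝ => ((Real.log c : ℝ) : ℂ)) 1 1 := by
      simpa using (Real.hasDerivAt_log (one_ne_zero)).ofReal_comp
    have := ((h3.const_mul (-a)).cexp).mul_const (W q)
    simpa using this
  have h4 : HasDerivAt (fun c : ℝ => W (c • q)) (-a * W q) 1 := by
    refine h2.congr_of_eventuallyEq ?_
    filter_upwards [lt_mem_nhds (zero_lt_one (α := ℝ))] with c hc
    exact h.hom c hc q hq
  have := h1.unique h4
  simpa using this

theorem Homog.euler2 {N : ℕ} {U : Set (ℝ × (EuclideanSpace ℝ (Fin N)))} {a : ℂ} {W : ℝ × (EuclideanSpace ℝ (Fin N)) → ℂ}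
    (h : Homog U a W) {q : ℝ × (EuclideanSpace ℝ (Fin N))} (hq : q ∈ U) (v : ℝ × (EuclideanSpace ℝ (Fin N))) :
    hess W q v q = -(a + 1) * fderiv ℝ W q v := by
  have hW := h.contDiffAt hq
  have h2 : DifferentiableAt ℝ (fderiv ℝ W) q :=
    (hW.fderiv_right (m := 1) (by norm_num)).differentiableAt (by simp)
  have h3 := h2.hasFDerivAt.clm_apply (hasFDerivAt_id q)
  have h4 : HasFDerivAt (fun z => -a * W z) ((-a) • fderiv ℝ W q) q :=
    (hW.differentiableAt (by simp)).hasFDerivAt.const_mul (-a)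
  have h5 : (fun z => fderiv ℝ W z (id z)) =ᶠ[nhds q] (fun z => -a * W z) := by
    filter_upwards [h.op.mem_nhds hq] with z hz
    exact h.euler1 hz
  have h6 := h3.unique (h4.congr_of_eventuallyEq h5)
  have h7 := congrArg (fun T => T v) h6
  simp at h7
  unfold hess
  linear_combination h7

theorem sum_single {N : ℕ} (y : EuclideanSpace ℝ (Fin N)) :
    ∑ i, (y i) • (EuclideanSpace.single i (1 : ℝ) : EuclideanSpace ℝ (Fin N)) = y := by
  have := (EuclideanSpace.basisFun (Fin N) ℝ).sum_repr y
  simpa using this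

theorem hess_sum_sum {N : ℕ} (B : (ℝ × (EuclideanSpace ℝ (Fin N))) →L[ℝ] (ℝ × (EuclideanSpace ℝ (Fin N))) →L[ℝ] ℂ) (y z : EuclideanSpace ℝ (Fin N)) :
    ∑ i, ∑ j, ((y i * z j : ℝ) : ℂ) * B (0, EuclideanSpace.single i 1)
      (0, EuclideanSpace.single j 1) = B (0, y) (0, z) := by
  have e : ∀ y : EuclideanSpace ℝ (Fin N), ((0 : ℝ), y) = ∑ i, (y i) • ((0 : ℝ), (EuclideanSpace.single i (1 : ℝ) : EuclideanSpace ℝ (Fin N))) := by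
    intro y
    have := congrArg (ContinuousLinearMap.inr ℝ ℝ (EuclideanSpace ℝ (Fin N))) (sum_single y)
    simp only [map_sum, map_smul, ContinuousLinearMap.inr_apply] at this
    exact this.symm
  conv_rhs => rw [e y, e z]
  simp only [map_sum, map_smul, _root_.sum_apply, _root_.smul_apply,
    Complex.real_smul, Finset.mul_sum]
  rw [Finset.sum_comm]
  refine Finset.sum_congr rfl fun i _ => Finset.sum_congr rfl fun j _ => ?_
  push_cast
  ring

theorem clm_sum {N : ℕ} (B : (ℝ × (EuclideanSpace ℝ (Fin N))) →L[ℝ] ℂ) (y : EuclideanSpace ℝ (Fin N)) :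
    ∑ i, ((y i : ℝ) : ℂ) * B (0, EuclideanSpace.single i 1) = B (0, y) := by
  have := congrArg (B.comp (ContinuousLinearMap.inr ℝ ℝ (EuclideanSpace ℝ (Fin N)))) (sum_single y)
  simpa only [map_sum, map_smul, ContinuousLinearMap.inr_apply, ContinuousLinearMap.comp_apply,
    Complex.real_smul] using this

theorem Homog.eigen_iff {N : ℕ} {U : Set (ℝ × (EuclideanSpace ℝ (Fin N)))} {p : ℝ} (hp : 1 < p) {lam : ℂ}
    {W : ℝ × (EuclideanSpace ℝ (Fin N)) → ℂ} (h : Homog U (lam + ((2 / (p - 1) : ℝ) : ℂ)) W) (d y : EuclideanSpace ℝ (Fin N))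
    (hq : ((1 : ℝ), y) ∈ U) (f : (EuclideanSpace ℝ (Fin N)) → ℂ) (hf : f =ᶠ[nhds y] fun x => W (1, x)) :
    EigenEqAt p d lam f y ↔
      box W (1, y) = ((p * kd p d y ^ (p - 1) : ℝ) : ℂ) * W (1, y) := by
  have hW := h.contDiffAt hq
  have hA : ∀ x : EuclideanSpace ℝ (Fin N), HasFDerivAt (fun z : EuclideanSpace ℝ (Fin N) => ((1 : ℝ), z))
      (ContinuousLinearMap.inr ℝ ℝ (EuclideanSpace ℝ (Fin N))) x := fun x => by
    simpa [ContinuousLinearMap.inr] using (hasFDerivAt_const (1 : ℝ) x).prodMk (hasFDerivAt_id x)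
  have h0 : f y = W (1, y) := hf.self_of_nhds
  have h1 : ∀ i, pdC i f y = fderiv ℝ W (1, y) (0, EuclideanSpace.single i 1) := by
    intro i
    unfold pdC
    rw [hf.fderiv_eq, (fderiv_comp_affine W _ _ hA y hW).self_of_nhds]
    simp
  have h2 : ∀ i j, pdC i (pdC j f) y
      = hess W (1, y) (0, EuclideanSpace.single i 1) (0, EuclideanSpace.single j 1) := by
    intro i j
    have hc := hess_comp_affine W _ _ hA y hW (EuclideanSpace.single i 1) (EuclideanSpace.single j 1)
    rw [← hess_congr hf] at hc
    simp only [ContinuousLinearMap.inr_apply] at hc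
    rw [← hc]
    have hf2 : ContDiffAt ℝ 2 f y := by
      refine ContDiffAt.congr_of_eventuallyEq ?_ hf
      exact ContDiffAt.comp y hW (contDiffAt_const.prodMk contDiffAt_id)
    have hf3 : DifferentiableAt ℝ (fderiv ℝ f) y :=
      (hf2.fderiv_right (m := 1) (by norm_num)).differentiableAt (by simp)
    unfold pdC hess
    rw [(hf3.hasFDerivAt.clm_apply (hasFDerivAt_const _ y)).fderiv]
    simp
  have hp' : ((p : ℂ) - 1) ≠ 0 := by
    have : p - 1 ≠ 0 := by linarith
    exact_mod_cast this
  have hs2 : (∑ i : Fin N, ∑ j : Fin N,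
        (((y i * y j - if i = j then (1 : ℝ) else 0) : ℝ) : ℂ) * pdC i (pdC j f) y)
      = hess W (1, y) (0, y) (0, y)
        - ∑ i : Fin N, hess W (1, y) (0, EuclideanSpace.single i 1) (0, EuclideanSpace.single i 1) := by
    have := hess_sum_sum (fderiv ℝ (fderiv ℝ W) (1, y)) y y
    simp only [hess] at h2 ⊢
    rw [← this, ← Finset.sum_sub_distrib]
    refine Finset.sum_congr rfl fun i _ => ?_
    simp only [h2, Complex.ofReal_sub, sub_mul, Finset.sum_sub_distrib]
    congr 1
    rw [Finset.sum_eq_single i] <;> simp +contextual [eq_comm]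
  have hs1 : (∑ i : Fin N, (y i : ℂ) * pdC i f y) = fderiv ℝ W (1, y) (0, y) := by
    simp only [h1]
    exact clm_sum _ y
  have hb : hess W (1, y) (1, 0) (1, 0)
      = (lam + ((2 / (p - 1) : ℝ) : ℂ)) * (lam + ((2 / (p - 1) : ℝ) : ℂ) + 1) * W (1, y)
        + 2 * (lam + ((2 / (p - 1) : ℝ) : ℂ) + 1) * fderiv ℝ W (1, y) (0, y)
        + hess W (1, y) (0, y) (0, y) := by
    have e1 := h.euler1 hq
    have e2 := h.euler2 hq ((1 : ℝ), y)
    have e3 := h.euler2 hq ((0 : ℝ), y)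
    have e4 := hess_symm hW ((0 : ℝ), y) ((1 : ℝ), y)
    have ed : ((1 : ℝ), (0 : EuclideanSpace ℝ (Fin N))) = ((1 : ℝ), y) - ((0 : ℝ), y) := by simp
    rw [ed]
    unfold hess at *
    simp only [map_sub, _root_.sub_apply]
    rw [← e4, e2, e3, e1]
    ring
  unfold EigenEqAt box
  rw [hs1, hs2, h0, hb]
  push_cast
  have c1 : ((p : ℂ) + 3) / (p - 1) = 2 * (2 / (p - 1)) + 1 := by field_simp; ring
  have c2 : 2 * ((p : ℂ) + 1) / (p - 1) ^ 2 = (2 / (p - 1)) * (2 / (p - 1) + 1) := by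
    field_simp; ring
  have c3 : 2 * ((p : ℂ) + 1) / (p - 1) = 2 * (2 / (p - 1) + 1) := by field_simp; ring
  rw [c1, c2, c3]
  constructor <;> intro hh <;> linear_combination hh

/-- The boost as a continuous linear map. -/
def bst {N : ℕ} (γ : ℝ) (d : EuclideanSpace ℝ (Fin N)) : (ℝ × (EuclideanSpace ℝ (Fin N))) →L[ℝ] (ℝ × (EuclideanSpace ℝ (Fin N))) :=
  ContinuousLinearMap.prod
    (γ • (ContinuousLinearMap.fst ℝ ℝ (EuclideanSpace ℝ (Fin N))
      - (innerSL ℝ d).comp (ContinuousLinearMap.snd ℝ ℝ (EuclideanSpace ℝ (Fin N)))))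
    (ContinuousLinearMap.snd ℝ ℝ (EuclideanSpace ℝ (Fin N))
      + (((γ ^ 2 / (1 + γ)) • (innerSL ℝ d).comp (ContinuousLinearMap.snd ℝ ℝ (EuclideanSpace ℝ (Fin N)))
          - γ • ContinuousLinearMap.fst ℝ ℝ (EuclideanSpace ℝ (Fin N)))).smulRight d)

theorem bst_apply {N : ℕ} (γ : ℝ) (d : EuclideanSpace ℝ (Fin N)) (q : ℝ × (EuclideanSpace ℝ (Fin N))) :
    bst γ d q = (γ * (q.1 - ⟪d, q.2⟫), q.2 + (γ ^ 2 / (1 + γ) * ⟪d, q.2⟫ - γ * q.1) • d) := by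
  simp [bst]

theorem bst_inv {N : ℕ} {γ : ℝ} {d : EuclideanSpace ℝ (Fin N)} (h0 : 0 < γ) (h : γ ^ 2 * (1 - ‖d‖ ^ 2) = 1)
    (q : ℝ × (EuclideanSpace ℝ (Fin N))) : bst γ d (bst γ (-d) q) = q := by
  have h1 : 1 + γ ≠ 0 := by positivity
  have hd : ‖d‖ ^ 2 = 1 - 1 / γ ^ 2 := by field_simp; linarith
  rw [bst_apply, bst_apply]
  obtain ⟨t, x⟩ := q
  simp only [inner_add_right, inner_neg_left, inner_neg_right, inner_smul_right,
    real_inner_self_eq_norm_sq, hd]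
  ext1
  · simp only
    field_simp
    ring
  · simp only [smul_neg, add_assoc, ← sub_eq_neg_add, ← sub_smul]
    rw [add_eq_left]
    convert zero_smul ℝ d using 2
    field_simp
    ring

theorem bst_mink {N : ℕ} {γ : ℝ} {d : EuclideanSpace ℝ (Fin N)} (h0 : 0 < γ) (h : γ ^ 2 * (1 - ‖d‖ ^ 2) = 1)
    (q : ℝ × (EuclideanSpace ℝ (Fin N))) : (bst γ d q).1 ^ 2 - ‖(bst γ d q).2‖ ^ 2 = q.1 ^ 2 - ‖q.2‖ ^ 2 := by
  have h1 : 1 + γ ≠ 0 := by positivity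
  have hd : ‖d‖ ^ 2 = 1 - 1 / γ ^ 2 := by field_simp; linarith
  rw [bst_apply]
  simp only [norm_add_sq_real, norm_smul, inner_smul_right, mul_pow, hd, Real.norm_eq_abs, sq_abs,
    real_inner_comm d]
  field_simp
  ring

theorem box_bst {N : ℕ} {γ : ℝ} {d : EuclideanSpace ℝ (Fin N)} (h0 : 0 < γ) (h : γ ^ 2 * (1 - ‖d‖ ^ 2) = 1)
    (W : ℝ × (EuclideanSpace ℝ (Fin N)) → ℂ) (q : ℝ × (EuclideanSpace ℝ (Fin N))) (hW : ContDiffAt ℝ 2 W (bst γ d q)) :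
    box (fun z => W (bst γ d z)) q = box W (bst γ d q) := by
  have h1 : 1 + γ ≠ 0 := by positivity
  have hd : ‖d‖ ^ 2 = 1 - 1 / γ ^ 2 := by field_simp; linarith
  have hc := hess_comp_affine W (bst γ d) (bst γ d) (fun x => (bst γ d).hasFDerivAt) q hW
  have hsy := hess_symm hW
  unfold box
  simp only [hc]
  generalize bst γ d q = Q at *
  unfold hess at *
  generalize fderiv ℝ (fderiv ℝ W) Q = B at *
  set k : ℝ := γ ^ 2 / (1 + γ) with hk
  have e1 : bst γ d (1, 0) = γ • ((1 : ℝ), (0 : EuclideanSpace ℝ (Fin N))) - γ • ((0 : ℝ), d) := by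
    rw [bst_apply]; simp
  have e2 : ∀ i : Fin N, bst γ d (0, EuclideanSpace.single i 1)
      = (-γ * d i) • ((1 : ℝ), (0 : EuclideanSpace ℝ (Fin N))) + ((0 : ℝ), (EuclideanSpace.single i 1 : EuclideanSpace ℝ (Fin N)))
        + (k * d i) • ((0 : ℝ), d) := by
    intro i; rw [bst_apply]; simp [EuclideanSpace.inner_single_right, hk]
  have e3 : ∀ i : Fin N, B (bst γ d (0, EuclideanSpace.single i 1))
      (bst γ d (0, EuclideanSpace.single i 1))
      = ((d i ^ 2 : ℝ) : ℂ) * (γ ^ 2 * B (1, 0) (1, 0) - 2 * γ * k * B (1, 0) (0, d)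
          + k ^ 2 * B (0, d) (0, d))
        + (d i : ℂ) * (B ((-2 * γ) • (1, 0) + (2 * k) • (0, d)) (0, EuclideanSpace.single i 1))
        + B (0, EuclideanSpace.single i 1) (0, EuclideanSpace.single i 1) := by
    intro i
    rw [e2]
    simp only [map_add, map_smul, _root_.add_apply, _root_.smul_apply,
      Complex.real_smul]
    rw [hsy (0, EuclideanSpace.single i 1) (1, 0), hsy (0, EuclideanSpace.single i 1) (0, d),
      hsy (0, d) (1, 0)]
    push_cast
    ring
  have e4 : ∑ i, ((d i ^ 2 : ℝ) : ℂ) = ((‖d‖ ^ 2 : ℝ) : ℂ) := by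
    rw [EuclideanSpace.real_norm_sq_eq]; push_cast; rfl
  rw [Finset.sum_congr rfl (fun i _ => e3 i), Finset.sum_add_distrib, Finset.sum_add_distrib,
    ← Finset.sum_mul, e4, clm_sum, e1, hd, hk]
  simp only [map_add, map_sub, map_smul, _root_.add_apply,
      _root_.sub_apply, _root_.smul_apply, Complex.real_smul]
  rw [hsy (0, d) (1, 0)]
  have g0 : (γ : ℂ) ≠ 0 := by exact_mod_cast h0.ne'
  have g1 : (1 + γ : ℂ) ≠ 0 := by exact_mod_cast h1
  push_cast
  field_simp
  ring

theorem homog_ext {N : ℕ} (a : ℂ) (φ : (EuclideanSpace ℝ (Fin N)) → ℂ) (Ω : Set (EuclideanSpace ℝ (Fin N))) (hΩ : IsOpen Ω)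
    (hφ : ContDiffOn ℝ (⊤ : ℕ∞) φ Ω) :
    Homog {q : ℝ × (EuclideanSpace ℝ (Fin N)) | 0 < q.1 ∧ q.1⁻¹ • q.2 ∈ Ω} a
      (fun q => Complex.exp (-a * (Real.log q.1 : ℝ)) * φ (q.1⁻¹ • q.2)) := by
  have hsm : ∀ q : ℝ × (EuclideanSpace ℝ (Fin N)), 0 < q.1 →
      ContDiffAt ℝ (⊤ : ℕ∞) (fun q : ℝ × (EuclideanSpace ℝ (Fin N)) => q.1⁻¹ • q.2) q := fun q hq =>
    (contDiffAt_fst.inv hq.ne').smul contDiffAt_snd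
  refine ⟨?_, ?_, ?_, ?_⟩
  · have ho : IsOpen {q : ℝ × (EuclideanSpace ℝ (Fin N)) | 0 < q.1} := isOpen_lt continuous_const continuous_fst
    have hc : ContinuousOn (fun q : ℝ × (EuclideanSpace ℝ (Fin N)) => q.1⁻¹ • q.2) {q : ℝ × (EuclideanSpace ℝ (Fin N)) | 0 < q.1} :=
      fun q hq => (hsm q hq).continuousAt.continuousWithinAt
    exact hc.isOpen_inter_preimage ho hΩ
  · rintro c hc ⟨t, x⟩ ⟨ht, hx⟩
    refine ⟨mul_pos hc ht, ?_⟩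
    have : (c * t)⁻¹ • c • x = t⁻¹ • x := by
      rw [smul_smul]; congr 1; simp at ht; field_simp
    simp only [Prod.smul_mk, smul_eq_mul, this]
    exact hx
  · rintro q ⟨hq, hx⟩
    refine ContDiffAt.contDiffWithinAt ?_
    refine ContDiffAt.mul ?_ ?_
    · refine ContDiffAt.cexp (contDiffAt_const.mul ?_)
      exact Complex.ofRealCLM.contDiff.contDiffAt.comp q (contDiffAt_fst.log hq.ne')
    · exact ContDiffAt.comp q (hφ.contDiffAt (hΩ.mem_nhds hx)) (hsm q hq)
  · rintro c hc ⟨t, x⟩ ⟨ht, hx⟩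
    simp only at ht
    have : (c * t)⁻¹ • c • x = t⁻¹ • x := by
      rw [smul_smul]; congr 1; field_simp
    simp only [Prod.smul_mk, smul_eq_mul, this]
    rw [Real.log_mul hc.ne' ht.ne', ← mul_assoc, ← Complex.exp_add]
    push_cast
    ring_nf

theorem Homog.comp_clm {N : ℕ} {U : Set (ℝ × (EuclideanSpace ℝ (Fin N)))} {a : ℂ} {W : ℝ × (EuclideanSpace ℝ (Fin N)) → ℂ}
    (h : Homog U a W) (L : (ℝ × (EuclideanSpace ℝ (Fin N))) →L[ℝ] (ℝ × (EuclideanSpace ℝ (Fin N)))) (c : ℂ) :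
    Homog (L ⁻¹' U) a (fun z => c * W (L z)) := by
  refine ⟨h.op.preimage L.continuous, ?_, ?_, ?_⟩
  · intro t ht q hq
    simpa using h.cone t ht (L q) hq
  · exact contDiffOn_const.mul (h.smooth.comp L.contDiff.contDiffOn (fun _ hx => hx))
  · intro t ht q hq
    simp only [map_smul]
    rw [h.hom t ht (L q) hq]
    ring

theorem kd_pow {N : ℕ} {p : ℝ} (hp : 1 < p) {d y : EuclideanSpace ℝ (Fin N)} (hd : 0 < 1 - ‖d‖ ^ 2)
    (hy : 0 < 1 + ⟪d, y⟫) :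
    kd p d y ^ (p - 1) = kappa0 p ^ (p - 1) * ((1 - ‖d‖ ^ 2) / (1 + ⟪d, y⟫) ^ 2) := by
  have h1 : p - 1 ≠ 0 := by linarith
  have hk : 0 ≤ kappa0 p := by
    unfold kappa0
    have : 0 < p + 1 := by linarith
    positivity
  unfold kd
  rw [Real.mul_rpow (by positivity) (by positivity), Real.mul_rpow hk (by positivity),
    ← Real.rpow_mul hd.le, ← Real.rpow_mul hy.le]
  have e1 : 1 / (p - 1) * (p - 1) = 1 := by field_simp
  have e2 : -(2 / (p - 1)) * (p - 1) = -(2 : ℝ) := by field_simp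
  rw [e1, e2, Real.rpow_one, Real.rpow_neg hy.le, Real.rpow_two]
  ring

theorem gamma_facts {N : ℕ} {d : EuclideanSpace ℝ (Fin N)} (hd : ‖d‖ < 1) {γ : ℝ}
    (hγ : γ = (1 - ‖d‖ ^ 2) ^ (-(1 / 2) : ℝ)) :
    0 < 1 - ‖d‖ ^ 2 ∧ 0 < γ ∧ γ ^ 2 * (1 - ‖d‖ ^ 2) = 1 := by
  have h : 0 < 1 - ‖d‖ ^ 2 := by nlinarith [norm_nonneg d]
  refine ⟨h, hγ ▸ Real.rpow_pos_of_pos h _, ?_⟩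
  rw [hγ, ← Real.rpow_natCast, ← Real.rpow_mul h.le]
  norm_num
  rw [Real.rpow_neg_one]
  exact inv_mul_cancel₀ h.ne'

theorem inner_lt {N : ℕ} {d y : EuclideanSpace ℝ (Fin N)} (hd : ‖d‖ < 1) (hy : ‖y‖ ≤ 1) : 0 < 1 - ⟪d, y⟫ := by
  have := real_inner_le_norm d y
  nlinarith [norm_nonneg d, norm_nonneg y]

theorem ymap_eq {N : ℕ} {d : EuclideanSpace ℝ (Fin N)} {γ : ℝ}
    (hγ : γ = (1 - ‖d‖ ^ 2) ^ (-(1 / 2) : ℝ)) (y : EuclideanSpace ℝ (Fin N)) :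
    ymap d y = (bst γ d (1, y)).1⁻¹ • (bst γ d (1, y)).2 := by
  unfold ymap
  rw [← hγ, bst_apply]
  simp only
  congr 1
  rw [mul_one, sub_smul, sub_add_eq_add_sub, add_sub_assoc, mul_div_right_comm]

theorem bst_one {N : ℕ} {d : EuclideanSpace ℝ (Fin N)} {γ : ℝ}
    (hγ : γ = (1 - ‖d‖ ^ 2) ^ (-(1 / 2) : ℝ)) (h0 : 0 < γ) (y : EuclideanSpace ℝ (Fin N)) (hy : 0 < 1 - ⟪d, y⟫) :
    bst γ d (1, y) = (γ * (1 - ⟪d, y⟫)) • (1, ymap d y) := by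
  have h1 : (bst γ d (1, y)).1 = γ * (1 - ⟪d, y⟫) := by rw [bst_apply]
  have h2 : γ * (1 - ⟪d, y⟫) ≠ 0 := by positivity
  ext1
  · simp [h1]
  · rw [ymap_eq hγ, h1]
    simp only [Prod.smul_snd]
    rw [smul_smul, mul_inv_cancel₀ h2, one_smul]

theorem ymap_ball {N : ℕ} {d : EuclideanSpace ℝ (Fin N)} (hd : ‖d‖ < 1) {y : EuclideanSpace ℝ (Fin N)} (hy : ‖y‖ ≤ 1) :
    ‖ymap d y‖ ≤ 1 := by
  obtain ⟨-, h0, h1⟩ := gamma_facts hd rfl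
  have hr := inner_lt hd hy
  have hm := bst_mink h0 h1 (1, y)
  rw [bst_one rfl h0 y hr] at hm
  set g := (1 - ‖d‖ ^ 2) ^ (-(1 / 2) : ℝ) * (1 - ⟪d, y⟫)
  have hg : 0 < g := by positivity
  simp only [Prod.smul_mk, smul_eq_mul, norm_smul, mul_one, mul_pow, Real.norm_eq_abs, sq_abs] at hm
  have h2 : 0 ≤ g ^ 2 * (1 - ‖ymap d y‖ ^ 2) := by nlinarith [norm_nonneg y]
  have h3 : 0 ≤ 1 - ‖ymap d y‖ ^ 2 := nonneg_of_mul_nonneg_right h2 (by positivity)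
  nlinarith [norm_nonneg (ymap d y)]

theorem ymap_inv {N : ℕ} {d : EuclideanSpace ℝ (Fin N)} (hd : ‖d‖ < 1) {y : EuclideanSpace ℝ (Fin N)} (hy : ‖y‖ ≤ 1) :
    ymap d (ymap (-d) y) = y := by
  obtain ⟨-, h0, h1⟩ := gamma_facts hd rfl
  have hd' : ‖-d‖ < 1 := by simpa using hd
  have hr' := inner_lt hd' hy
  have hr := inner_lt hd (ymap_ball hd' hy)
  have hi := bst_inv h0 h1 (1, y)
  rw [bst_one (by simp) h0 y hr', map_smul, bst_one rfl h0 _ hr, smul_smul] at hi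
  have a1 := congrArg Prod.fst hi
  have a2 := congrArg Prod.snd hi
  simp only [Prod.smul_mk, smul_eq_mul, mul_one] at a1 a2
  rw [a1, one_smul] at a2
  exact a2

theorem one_add_inner_ymap {N : ℕ} {d : EuclideanSpace ℝ (Fin N)} {γ : ℝ} (hd : ‖d‖ < 1)
    (hγ : γ = (1 - ‖d‖ ^ 2) ^ (-(1 / 2) : ℝ)) (y : EuclideanSpace ℝ (Fin N)) (hy : 0 < 1 - ⟪d, y⟫) :
    1 + ⟪d, ymap d y⟫ = 1 / (γ ^ 2 * (1 - ⟪d, y⟫)) := by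
  obtain ⟨-, h0, h1⟩ := gamma_facts hd hγ
  have h2 : 1 + γ ≠ 0 := by positivity
  have hn : ‖d‖ ^ 2 = 1 - 1 / γ ^ 2 := by field_simp; linarith
  rw [ymap_eq hγ, bst_apply]
  simp only [inner_smul_right, inner_add_right, real_inner_self_eq_norm_sq, hn]
  have := hy.ne'
  field_simp
  ring

end Helpers

/-- Transformation of the eigen-equation: if `φ` is smooth near the closed unit ball and
satisfies the eigen-equation for `(d, λ)`, then
`ψ(y') = (1 − d⬝y')^{−λ} (γ(1 − d⬝y'))^{−2/(p−1)} φ(ymap d y')` is smooth near the closed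
unit ball, satisfies the eigen-equation for `(0, λ)`, and is nontrivial whenever `φ` is. -/
theorem eigen_equation_transform (N : ℕ) (hN : 1 ≤ N) (p : ℝ) (hp : 1 < p)
    (d : EuclideanSpace ℝ (Fin N)) (hd : ‖d‖ < 1)
    (γ : ℝ) (hγ : γ = (1 - ‖d‖ ^ 2) ^ (-(1 / 2) : ℝ)) (lam : ℂ)
    (φ : EuclideanSpace ℝ (Fin N) → ℂ)
    (Ω : Set (EuclideanSpace ℝ (Fin N))) (hΩ : IsOpen Ω)
    (hball : Metric.closedBall 0 1 ⊆ Ω)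
    (hφ : ContDiffOn ℝ (⊤ : ℕ∞) φ Ω)
    (heq : ∀ y ∈ Metric.closedBall (0 : EuclideanSpace ℝ (Fin N)) 1, EigenEqAt p d lam φ y)
    (ψ : EuclideanSpace ℝ (Fin N) → ℂ)
    (hψ : ∀ y' : EuclideanSpace ℝ (Fin N), ψ y' =
      ((1 - ⟪d, y'⟫ : ℝ) : ℂ) ^ (-lam)
        * (((γ * (1 - ⟪d, y'⟫)) ^ (-(2 / (p - 1))) : ℝ) : ℂ) * φ (ymap d y')) :
    (∀ y' ∈ Metric.closedBall (0 : EuclideanSpace ℝ (Fin N)) 1,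
        ymap d y' ∈ Metric.closedBall (0 : EuclideanSpace ℝ (Fin N)) 1) ∧
    (∃ Ω' : Set (EuclideanSpace ℝ (Fin N)), IsOpen Ω' ∧
        Metric.closedBall 0 1 ⊆ Ω' ∧ ContDiffOn ℝ (⊤ : ℕ∞) ψ Ω') ∧
    (∀ y' ∈ Metric.closedBall (0 : EuclideanSpace ℝ (Fin N)) 1,
        EigenEqAt p (0 : EuclideanSpace ℝ (Fin N)) lam ψ y') ∧
    ((∃ y ∈ Metric.closedBall (0 : EuclideanSpace ℝ (Fin N)) 1, φ y ≠ 0) →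
      ∃ y' ∈ Metric.closedBall (0 : EuclideanSpace ℝ (Fin N)) 1, ψ y' ≠ 0) := by
  obtain ⟨hd1, h0, h1⟩ := gamma_facts hd hγ
  have hmaps : ∀ y' ∈ Metric.closedBall (0 : EuclideanSpace ℝ (Fin N)) 1,
        ymap d y' ∈ Metric.closedBall (0 : EuclideanSpace ℝ (Fin N)) 1 := by
    intro y hy
    rw [mem_closedBall_zero_iff] at hy ⊢
    exact ymap_ball hd hy
  set a : ℂ := lam + ((2 / (p - 1) : ℝ) : ℂ) with ha
  have hW := homog_ext a φ Ω hΩ hφ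
  set U : Set (ℝ × EuclideanSpace ℝ (Fin N)) := {q | 0 < q.1 ∧ q.1⁻¹ • q.2 ∈ Ω} with hU
  set W : ℝ × EuclideanSpace ℝ (Fin N) → ℂ :=
    fun q => Complex.exp (-a * (Real.log q.1 : ℝ)) * φ (q.1⁻¹ • q.2) with hWdef
  set c : ℂ := Complex.exp (lam * (Real.log γ : ℝ)) with hc
  have hV := hW.comp_clm (bst γ d) c
  have hmem : ∀ y ∈ Metric.closedBall (0 : EuclideanSpace ℝ (Fin N)) 1, ((1 : ℝ), y) ∈ U := by
    intro y hy
    refine ⟨one_pos, ?_⟩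
    simpa using hball hy
  have hpos : ∀ y ∈ Metric.closedBall (0 : EuclideanSpace ℝ (Fin N)) 1, 0 < 1 - ⟪d, y⟫ := by
    intro y hy
    exact inner_lt hd (mem_closedBall_zero_iff.1 hy)
  have hmem' : ∀ y ∈ Metric.closedBall (0 : EuclideanSpace ℝ (Fin N)) 1,
      ((1 : ℝ), y) ∈ bst γ d ⁻¹' U := by
    intro y hy
    have hr := hpos y hy
    rw [Set.mem_preimage, bst_one hγ h0 y hr]
    exact hW.cone _ (by positivity) _ (hmem _ (hmaps y hy))
  have hψV : ∀ y, ((1 : ℝ), y) ∈ bst γ d ⁻¹' U → ψ y = c * W (bst γ d (1, y)) := by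
    intro y hy
    have hg : 0 < (bst γ d (1, y)).1 := hy.1
    have hy1 : (bst γ d (1, y)).1 = γ * (1 - ⟪d, y⟫) := by rw [bst_apply]
    have hr : 0 < 1 - ⟪d, y⟫ := by
      rw [hy1] at hg
      exact pos_of_mul_pos_right hg h0.le
    simp only [hWdef]
    rw [hψ, ymap_eq hγ, hy1, Complex.cpow_def_of_ne_zero (by exact_mod_cast hr.ne'),
      Real.rpow_def_of_pos (by positivity), ← Complex.ofReal_log hr.le,
      Real.log_mul h0.ne' hr.ne', ← mul_assoc, hc, Complex.ofReal_exp, ← Complex.exp_add,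
      ← Complex.exp_add, ha]
    congr 2
    push_cast
    ring
  have hcont : Continuous (fun y : EuclideanSpace ℝ (Fin N) => ((1 : ℝ), y)) := by fun_prop
  have hΩ' : IsOpen {y : EuclideanSpace ℝ (Fin N) | ((1 : ℝ), y) ∈ bst γ d ⁻¹' U} :=
    hV.op.preimage hcont
  refine ⟨hmaps, ⟨_, hΩ', hmem', ?_⟩, ?_, ?_⟩
  · refine ContDiffOn.congr ?_ hψV
    exact hV.smooth.comp (contDiff_const.prodMk contDiff_id).contDiffOn (fun y hy => hy)
  · intro y hy
    have hr := hpos y hy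
    have hgp : 0 < γ * (1 - ⟪d, y⟫) := by positivity
    have hψe : ψ =ᶠ[nhds y] fun x => c * W (bst γ d (1, x)) := by
      filter_upwards [hΩ'.mem_nhds (hmem' y hy)] with z hz
      exact hψV z hz
    rw [hV.eigen_iff hp 0 y (hmem' y hy) ψ hψe]
    have hY := heq _ (hmaps y hy)
    rw [hW.eigen_iff hp d (ymap d y) (hmem _ (hmaps y hy)) φ
      (Filter.Eventually.of_forall (fun x => by simp [hWdef]))] at hY
    rw [box_const_mul (fun z => W (bst γ d z)),
      box_bst h0 h1 W _ (hW.contDiffAt (hmem' y hy))]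
    have hs := hW.box_smul (hmem _ (hmaps y hy)) _ hgp
    rw [hY] at hs
    have hh := hW.hom _ hgp _ (hmem _ (hmaps y hy))
    rw [← bst_one hγ h0 y hr] at hs hh
    rw [hh]
    have hone := one_add_inner_ymap hd hγ y hr
    have hk1 := kd_pow hp (d := d) (y := ymap d y) hd1 (by rw [hone]; positivity)
    have hk0 := kd_pow hp (d := (0 : EuclideanSpace ℝ (Fin N))) (y := y) (by simp) (by simp)
    have hk : kd p d (ymap d y) ^ (p - 1)
        = (γ * (1 - ⟪d, y⟫)) ^ 2 * kd p (0 : EuclideanSpace ℝ (Fin N)) y ^ (p - 1) := by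
      rw [hk1, hk0, hone]
      have hn : 1 - ‖d‖ ^ 2 = 1 / γ ^ 2 := by field_simp; linarith
      rw [hn]
      simp
      field_simp
    rw [hk] at hs
    have hg0 : ((γ * (1 - ⟪d, y⟫) : ℝ) : ℂ) ^ 2 ≠ 0 := by
      exact pow_ne_zero _ (by exact_mod_cast hgp.ne')
    apply mul_left_cancel₀ hg0
    simp only [Complex.ofReal_mul, Complex.ofReal_pow] at hs ⊢
    linear_combination c * hs
  · rintro ⟨y, hy, hne⟩
    have hy' : ‖y‖ ≤ 1 := mem_closedBall_zero_iff.1 hy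
    have hd' : ‖-d‖ < 1 := by simpa using hd
    have hz : ymap (-d) y ∈ Metric.closedBall (0 : EuclideanSpace ℝ (Fin N)) 1 :=
      mem_closedBall_zero_iff.2 (ymap_ball hd' hy')
    have hr := hpos _ hz
    refine ⟨ymap (-d) y, hz, ?_⟩
    rw [hψ, ymap_inv hd hy']
    refine mul_ne_zero (mul_ne_zero ?_ ?_) hne
    · rw [Complex.cpow_def_of_ne_zero (by exact_mod_cast hr.ne')]
      exact Complex.exp_ne_zero _
    · exact_mod_cast (Real.rpow_pos_of_pos (by positivity) _).ne'

end
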